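/- Let D_n(α) = det(M_{j−k})_{j,k=0}^{n−1} with M_k = (1/2π)∫_α^{2π−α} e^{−ikθ} dθ. Then for fixed n ≥ 1, as β = π − α → 0⁺, ln D_n(α) = n² ln β − n ln(2π) + ln A_n + O_n(β²), where A_n = ∏_{k=0}^{n−1} (2^{2k}(k!)^4/((2k)!)^2) · 2/(2k+1). -/

import Mathlib

open Complex MeasureTheory intervalIntegral

/-- The Fourier coefficients `M_k = (1/2π)∫_α^{2π−α} e^{−ikθ} dθ` of the
characteristic function of the arc `(α, 2π−α)`. -/
noncomputable def toeplitzSymbol (α : ℝ) (k : ℤ) : ℂ :=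
  (1 / (2 * Real.pi)) * ∫ θ in α..(2 * Real.pi - α),
    Complex.exp (-Complex.I * (k : ℂ) * (θ : ℂ))

/-- The Toeplitz determinant `D_n(α) = det(M_{j−k})_{j,k=0}^{n−1}`. -/
noncomputable def toeplitzDet (n : ℕ) (α : ℝ) : ℂ :=
  Matrix.det (Matrix.of fun j k : Fin n => toeplitzSymbol α ((j : ℤ) - (k : ℤ)))

/-- The entire function `c ↦ (exp c - 1) / c`, the mean of `u ↦ exp (c * u)` over `[0, 1]`. -/
noncomputable def expMean : ℂ → ℂ := dslope Complex.exp 0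

lemma differentiable_expMean : Differentiable ℂ expMean := by
  rw [← differentiableOn_univ, expMean, Complex.differentiableOn_dslope Filter.univ_mem]
  exact Complex.differentiable_exp.differentiableOn

lemma expMean_zero : expMean 0 = 1 := by
  simp [expMean]

lemma mul_expMean (c : ℂ) : c * expMean c = Complex.exp c - 1 := by
  simpa [expMean] using sub_smul_dslope Complex.exp 0 c

lemma integral_exp_mul (c : ℂ) : ∫ u in (0 : ℝ)..1, Complex.exp (c * u) = expMean c := by
  rcases eq_or_ne c 0 with rfl | hc
  · simp [expMean_zero]
  · rw [integral_exp_mul_complex hc, div_eq_iff hc, mul_comm (expMean c), mul_expMean]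
    simp

/-- The Toeplitz determinant of the arc of angular length `x`, normalised to total mass one and
rotated to start at angle zero, for complex `x`. -/
noncomputable def arcDet (n : ℕ) (x : ℂ) : ℂ :=
  Matrix.det (Matrix.of fun j k : Fin n => expMean (-I * ((j : ℂ) - (k : ℂ)) * x))

/-- The determinant `arcDet n x` after division by `x ^ (n * (n - 1))`, in a form that extends
continuously to `x = 0`. -/
noncomputable def scaledArcDet (n : ℕ) (x : ℂ) : ℂ :=
  Matrix.det (Matrix.of fun j k : Fin n => ∫ u in (0 : ℝ)..1,
    (-I * u * expMean (-I * x * u)) ^ (j : ℕ) * (I * u * expMean (I * x * u)) ^ (k : ℕ))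

lemma differentiable_arcDet (n : ℕ) : Differentiable ℂ (arcDet n) := by
  unfold arcDet
  simp only [Matrix.det_apply, Matrix.of_apply]
  have h := differentiable_expMean
  have h' : ∀ j k : Fin n,
      Differentiable ℂ fun x : ℂ => expMean (-I * ((j : ℂ) - (k : ℂ)) * x) := fun j k =>
    h.comp (by fun_prop)
  fun_prop

lemma arcDet_neg (n : ℕ) (x : ℂ) : arcDet n (-x) = arcDet n x := by
  unfold arcDet
  rw [← Matrix.det_transpose]
  congr 1
  ext j k
  simp only [Matrix.transpose_apply, Matrix.of_apply]
  congr 1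
  ring

lemma continuous_scaledArcDet (n : ℕ) : Continuous (scaledArcDet n) := by
  refine Continuous.matrix_det (continuous_matrix fun j k => ?_)
  have h := differentiable_expMean.continuous
  refine intervalIntegral.continuous_parametric_intervalIntegral_of_continuous' ?_ 0 1
  simp only [Function.uncurry_def]
  fun_prop

/-- The lower triangular matrix of binomial coefficients is unimodular. -/
lemma det_choose (n : ℕ) :
    Matrix.det (Matrix.of fun j a : Fin n => ((j : ℕ).choose (a : ℕ) : ℂ)) = 1 := by
  rw [Matrix.det_of_isLowerTriangular]
  · simp
  · intro i j hij
    simpa using Nat.choose_eq_zero_of_lt (by simpa using hij)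

lemma sum_choose_mul_pow (n : ℕ) (j : Fin n) (y : ℂ) :
    ∑ a : Fin n, ((j : ℕ).choose (a : ℕ) : ℂ) * y ^ (a : ℕ) = (y + 1) ^ (j : ℕ) := by
  rw [Fin.sum_univ_eq_sum_range (fun a => ((j : ℕ).choose a : ℂ) * y ^ a) n, add_pow]
  symm
  refine (Finset.sum_subset (Finset.range_subset_range.2 j.2) fun a _ ha => ?_).trans ?_
  · rw [Nat.choose_eq_zero_of_lt (by simpa using ha)]
    simp
  · exact Finset.sum_congr rfl fun a _ => by simp [mul_comm]

lemma arcDet_eq (n : ℕ) (x : ℂ) : arcDet n x = x ^ (n * (n - 1)) * scaledArcDet n x := by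
  have hc := differentiable_expMean.continuous
  set P : Matrix (Fin n) (Fin n) ℂ := Matrix.of fun j a => ((j : ℕ).choose (a : ℕ) : ℂ) with hP
  set H : Matrix (Fin n) (Fin n) ℂ := Matrix.of fun j k => ∫ u in (0 : ℝ)..1,
    (-I * u * expMean (-I * x * u)) ^ (j : ℕ) * (I * u * expMean (I * x * u)) ^ (k : ℕ) with hH
  set D : Matrix (Fin n) (Fin n) ℂ := Matrix.diagonal fun j => x ^ (j : ℕ) with hD
  have key : (Matrix.of fun j k : Fin n => expMean (-I * ((j : ℂ) - (k : ℂ)) * x))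
      = P * (D * H * D) * P.transpose := by
    ext j k
    have hpow : ∀ u : ℝ, Complex.exp (-I * ((j : ℂ) - (k : ℂ)) * x * u)
        = ∑ b : Fin n, ∑ a : Fin n, ((j : ℕ).choose (a : ℕ) * (x ^ (a : ℕ) *
          ((-I * u * expMean (-I * x * u)) ^ (a : ℕ) * (I * u * expMean (I * x * u)) ^ (b : ℕ))
          * x ^ (b : ℕ)) * (k : ℕ).choose (b : ℕ)) := by
      intro u
      have e1 : Complex.exp (-I * x * u) = x * (-I * u * expMean (-I * x * u)) + 1 := by
        linear_combination -mul_expMean (-I * x * u)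
      have e2 : Complex.exp (I * x * u) = x * (I * u * expMean (I * x * u)) + 1 := by
        linear_combination -mul_expMean (I * x * u)
      have e3 : Complex.exp (-I * ((j : ℂ) - (k : ℂ)) * x * u)
          = Complex.exp (-I * x * u) ^ (j : ℕ) * Complex.exp (I * x * u) ^ (k : ℕ) := by
        rw [← Complex.exp_nat_mul, ← Complex.exp_nat_mul, ← Complex.exp_add]
        congr 1
        ring
      rw [e3, e1, e2, ← sum_choose_mul_pow n j, ← sum_choose_mul_pow n k, Finset.sum_mul_sum,
        Finset.sum_comm]
      refine Finset.sum_congr rfl fun b _ => Finset.sum_congr rfl fun a _ => ?_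
      rw [mul_pow, mul_pow x]
      ring
    have hDHD : ∀ a b, (D * H * D) a b = x ^ (a : ℕ) * H a b * x ^ (b : ℕ) := fun a b => by
      rw [hD, Matrix.mul_diagonal, Matrix.diagonal_mul]
    have hsum : ∀ M : Matrix (Fin n) (Fin n) ℂ, (P * M * P.transpose) j k
        = ∑ b : Fin n, ∑ a : Fin n, P j a * M a b * P k b := fun M => by
      simp only [Matrix.mul_apply, Matrix.transpose_apply, Finset.sum_mul]
    rw [hsum, Matrix.of_apply]
    simp only [hDHD]
    simp only [Matrix.of_apply, hP, hH]
    rw [← integral_exp_mul]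
    simp_rw [hpow]
    rw [intervalIntegral.integral_finsetSum
      fun b _ => Continuous.intervalIntegrable (by fun_prop) _ _]
    refine Finset.sum_congr rfl fun b _ => ?_
    rw [intervalIntegral.integral_finsetSum
      fun a _ => Continuous.intervalIntegrable (by fun_prop) _ _]
    refine Finset.sum_congr rfl fun a _ => ?_
    rw [intervalIntegral.integral_mul_const, intervalIntegral.integral_const_mul,
      intervalIntegral.integral_mul_const, intervalIntegral.integral_const_mul]
  have hdet : D.det * D.det = x ^ (n * (n - 1)) := by
    rw [hD, Matrix.det_diagonal, Finset.prod_pow_eq_pow_sum,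
      Fin.sum_univ_eq_sum_range (fun a => a) n, ← pow_add, ← Finset.sum_range_id_mul_two, mul_two]
  rw [arcDet, key, Matrix.det_mul, Matrix.det_mul, Matrix.det_transpose, hP, det_choose,
    Matrix.det_mul, Matrix.det_mul, ← hdet, scaledArcDet]
  ring

lemma scaledArcDet_neg (n : ℕ) (x : ℂ) : scaledArcDet n (-x) = scaledArcDet n x := by
  rcases eq_or_ne x 0 with rfl | hx
  · simp
  · have h := arcDet_neg n x
    rw [arcDet_eq, arcDet_eq, (Nat.even_mul_pred_self n).neg_pow] at h
    exact mul_left_cancel₀ (pow_ne_zero _ hx) h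

lemma analyticAt_scaledArcDet (n : ℕ) : AnalyticAt ℂ (scaledArcDet n) 0 := by
  refine Complex.analyticAt_of_differentiable_on_punctured_nhds_of_continuousAt ?_
    (continuous_scaledArcDet n).continuousAt
  filter_upwards [self_mem_nhdsWithin] with z hz
  have hz : z ≠ 0 := hz
  have h : DifferentiableAt ℂ (fun x => arcDet n x / x ^ (n * (n - 1))) z :=
    (differentiable_arcDet n z).div (by fun_prop) (pow_ne_zero _ hz)
  refine h.congr_of_eventuallyEq ?_
  filter_upwards [isOpen_ne.mem_nhds hz] with x hx
  rw [arcDet_eq, mul_div_cancel_left₀ _ (pow_ne_zero _ hx)]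

/-- An even function that is analytic at `0` is constant there up to a quadratic error. -/
lemma AnalyticAt.isBigO_sub_of_even {f : ℂ → ℂ} (hf : AnalyticAt ℂ f 0)
    (heven : ∀ x, f (-x) = f x) :
    (fun x => f x - f 0) =O[nhds 0] fun x => ‖x‖ ^ 2 := by
  obtain ⟨p, hp⟩ := hf
  have h := hp.isBigO_sub_partialSum_pow 2
  have hneg : (fun x => f (0 + -x) - p.partialSum 2 (-x)) =O[nhds 0] fun x : ℂ => ‖x‖ ^ 2 := by
    have ht : Filter.Tendsto (fun x : ℂ => -x) (nhds 0) (nhds 0) := by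
      simpa using (continuous_neg (G := ℂ)).tendsto 0
    simpa [Function.comp_def] using h.comp_tendsto ht
  refine ((h.add hneg).const_mul_left (1 / 2)).congr_left fun x => ?_
  have h0 : ∀ y : ℂ, p 0 (fun _ => y) = f 0 := fun y => hp.coeff_zero _
  have h1 : p 1 (fun _ => -x) = -p 1 (fun _ => x) := by simp
  simp only [FormalMultilinearSeries.partialSum, Finset.sum_range_succ, Finset.sum_range_zero,
    zero_add, heven, h0, h1]
  ring

/-- Expansion of a determinant along the Schur complement of its last diagonal entry. -/
lemma Matrix.det_succ_eq_last_mul_det_schur {K : Type*} [Field K] {n : ℕ}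
    (A : Matrix (Fin (n + 1)) (Fin (n + 1)) K) (h : A (Fin.last n) (Fin.last n) ≠ 0) :
    A.det = A (Fin.last n) (Fin.last n) * Matrix.det (Matrix.of fun i j : Fin n =>
      A i.castSucc j.castSucc - A i.castSucc (Fin.last n) * A (Fin.last n) j.castSucc
        / A (Fin.last n) (Fin.last n)) := by
  have e1 : ∀ i : Fin n, finSumFinEquiv (Sum.inl i : Fin n ⊕ Fin 1) = i.castSucc := fun i => rfl
  have e2 : ∀ i : Fin 1, finSumFinEquiv (Sum.inr i : Fin n ⊕ Fin 1) = Fin.last n := fun i => by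
    ext; simp
  set B := A.submatrix (finSumFinEquiv (m := n) (n := 1)) finSumFinEquiv with hB
  have hdet : B.toBlocks₂₂.det = A (Fin.last n) (Fin.last n) := by
    simp [Matrix.toBlocks₂₂, hB, e2, -finSumFinEquiv_apply_right]
  have : Invertible B.toBlocks₂₂ :=
    Matrix.invertibleOfIsUnitDet _ (by rw [hdet]; exact h.isUnit)
  rw [← Matrix.det_submatrix_equiv_self (finSumFinEquiv (m := n) (n := 1)) A, ← hB,
    ← Matrix.fromBlocks_toBlocks B, Matrix.det_fromBlocks₂₂, hdet]
  congr 2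
  ext i j
  have hinv : B.toBlocks₂₂⁻¹ 0 0 = (A (Fin.last n) (Fin.last n))⁻¹ := by
    rw [Matrix.inv_def, hdet]
    simp
  simp only [Matrix.sub_apply, Matrix.mul_apply, Matrix.invOf_eq_nonsing_inv, Finset.univ_unique,
    Fin.default_eq_zero, Finset.sum_singleton, hinv]
  simp only [Matrix.of_apply, Matrix.toBlocks₁₁, Matrix.toBlocks₁₂, Matrix.toBlocks₂₁, hB,
    Matrix.submatrix_apply, e1, e2]
  ring

/-- The product formula for the determinant of the Hilbert matrix. -/
lemma det_hilbert (n : ℕ) :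
    Matrix.det (Matrix.of fun j k : Fin n => (1 : ℂ) / ((j : ℂ) + (k : ℂ) + 1))
      = ∏ k ∈ Finset.range n,
        ((k.factorial : ℂ) ^ 4 / ((2 * k).factorial : ℂ) ^ 2 * (1 / (2 * (k : ℂ) + 1))) := by
  induction n with
  | zero => simp
  | succ n ih =>
    have hne : ∀ m : ℕ, (m : ℂ) + 1 ≠ 0 := Nat.cast_add_one_ne_zero
    rw [Matrix.det_succ_eq_last_mul_det_schur, Finset.prod_range_succ, ← ih]
    swap
    · have := hne (n + n)
      push_cast at this
      simpa using this
    set v : Fin n → ℂ := fun i => ((n : ℂ) - i) / ((i : ℂ) + n + 1) with hv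
    have hS : (Matrix.of fun i j : Fin n =>
        (Matrix.of fun j k : Fin (n + 1) => (1 : ℂ) / ((j : ℂ) + (k : ℂ) + 1)) i.castSucc j.castSucc
        - (Matrix.of fun j k : Fin (n + 1) => (1 : ℂ) / ((j : ℂ) + (k : ℂ) + 1))
            i.castSucc (Fin.last n)
          * (Matrix.of fun j k : Fin (n + 1) => (1 : ℂ) / ((j : ℂ) + (k : ℂ) + 1))
            (Fin.last n) j.castSucc
          / (Matrix.of fun j k : Fin (n + 1) => (1 : ℂ) / ((j : ℂ) + (k : ℂ) + 1))
            (Fin.last n) (Fin.last n))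
        = Matrix.of fun i j : Fin n => v i * Matrix.of (fun i j : Fin n => v j *
          Matrix.of (fun j k : Fin n => (1 : ℂ) / ((j : ℂ) + (k : ℂ) + 1)) i j) i j := by
      ext i j
      have h1 := hne (i + j)
      have h2 := hne (i + n)
      have h3 := hne (n + j)
      have h4 := hne (n + n)
      have h5 := hne (j + n)
      push_cast at h1 h2 h3 h4 h5
      simp only [Matrix.of_apply, Fin.val_castSucc, Fin.val_last, hv]
      field_simp
      ring
    have hfac : ((2 * n).factorial : ℂ) = n.factorial * ∏ i : Fin n, ((i : ℂ) + n + 1) := by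
      rw [two_mul, ← Nat.factorial_mul_ascFactorial, Nat.ascFactorial_eq_prod_range,
        Fin.prod_univ_eq_prod_range (fun i => (i : ℂ) + n + 1) n]
      push_cast
      congr 1
      exact Finset.prod_congr rfl fun i _ => by ring
    have hnum : ∏ i : Fin n, ((n : ℂ) - i) = n.factorial := by
      rw [Fin.prod_univ_eq_prod_range (fun i => (n : ℂ) - i) n, ← Nat.descFactorial_self,
        Nat.descFactorial_eq_prod_range]
      push_cast
      exact Finset.prod_congr rfl fun i hi => by
        rw [Nat.cast_sub (Finset.mem_range.1 hi).le]
    have hvprod : ∏ i, v i = (n.factorial : ℂ) ^ 2 / (2 * n).factorial := by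
      have hn : (n.factorial : ℂ) ≠ 0 := Nat.cast_ne_zero.2 n.factorial_ne_zero
      rw [hv, Finset.prod_div_distrib, hnum, hfac, pow_two, mul_div_mul_left _ _ hn]
    rw [hS, Matrix.det_mul_column, Matrix.det_mul_row, hvprod]
    simp only [Matrix.of_apply, Fin.val_last]
    rw [← two_mul]
    ring

lemma scaledArcDet_zero (n : ℕ) :
    scaledArcDet n 0 = ∏ k ∈ Finset.range n,
      ((k.factorial : ℂ) ^ 4 / ((2 * k).factorial : ℂ) ^ 2 * (1 / (2 * (k : ℂ) + 1))) := by
  rw [← det_hilbert, scaledArcDet]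
  have h : (Matrix.of fun j k : Fin n => ∫ u in (0 : ℝ)..1,
      (-I * u * expMean (-I * 0 * u)) ^ (j : ℕ) * (I * u * expMean (I * 0 * u)) ^ (k : ℕ))
      = Matrix.of fun j k : Fin n => (-I) ^ (j : ℕ) * Matrix.of (fun j k : Fin n =>
        I ^ (k : ℕ) * Matrix.of (fun j k : Fin n => (1 : ℂ) / ((j : ℂ) + (k : ℂ) + 1)) j k) j k := by
    ext j k
    have hu : ∀ u : ℝ, (-I * u * expMean (-I * 0 * u)) ^ (j : ℕ)
        * (I * u * expMean (I * 0 * u)) ^ (k : ℕ)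
        = (-I) ^ (j : ℕ) * I ^ (k : ℕ) * ((u ^ ((j : ℕ) + (k : ℕ)) : ℝ) : ℂ) := by
      intro u
      simp only [mul_zero, zero_mul, expMean_zero]
      push_cast
      ring
    simp only [Matrix.of_apply, hu]
    rw [intervalIntegral.integral_const_mul, intervalIntegral.integral_ofReal, integral_pow]
    simp [mul_assoc]
  rw [h, Matrix.det_mul_column, Matrix.det_mul_row, ← mul_assoc, ← Finset.prod_mul_distrib]
  simp [← mul_pow]

lemma toeplitzSymbol_eq (β : ℝ) (l : ℤ) :
    toeplitzSymbol (Real.pi - β) l = (((2 * β) / (2 * Real.pi) : ℝ) : ℂ) *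
      (Complex.exp (-I * l * (Real.pi - β)) * expMean (-I * l * (2 * β))) := by
  have h := intervalIntegral.smul_integral_comp_mul_add (a := 0) (b := 1)
    (fun θ : ℝ => Complex.exp (-I * l * θ)) (2 * β) (Real.pi - β)
  have e : ∀ u : ℝ, Complex.exp (-I * l * ((2 * β * u + (Real.pi - β) : ℝ) : ℂ))
      = Complex.exp (-I * l * (Real.pi - β)) * Complex.exp (-I * l * (2 * β) * u) := by
    intro u
    rw [← Complex.exp_add]
    congr 1
    push_cast
    ring
  simp_rw [e] at h
  rw [intervalIntegral.integral_const_mul, integral_exp_mul] at h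
  rw [toeplitzSymbol, show 2 * Real.pi - (Real.pi - β) = 2 * β * 1 + (Real.pi - β) by ring]
  rw [mul_zero, zero_add] at h
  rw [← h, Complex.real_smul]
  push_cast
  ring

lemma toeplitzDet_eq_arcDet (n : ℕ) (β : ℝ) :
    toeplitzDet n (Real.pi - β)
      = (((2 * β) / (2 * Real.pi) : ℝ) : ℂ) ^ n * arcDet n ((2 * β : ℝ) : ℂ) := by
  set c : ℂ := (((2 * β) / (2 * Real.pi) : ℝ) : ℂ) with hc
  have h : (Matrix.of fun j k : Fin n => toeplitzSymbol (Real.pi - β) ((j : ℤ) - (k : ℤ)))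
      = c • Matrix.of fun j k : Fin n => Complex.exp (-I * j * (Real.pi - β)) *
        Matrix.of (fun j k : Fin n => Complex.exp (I * k * (Real.pi - β)) *
          Matrix.of (fun j k : Fin n =>
            expMean (-I * ((j : ℂ) - (k : ℂ)) * ((2 * β : ℝ) : ℂ))) j k) j k := by
    ext j k
    simp only [Matrix.smul_apply, Matrix.of_apply, smul_eq_mul]
    rw [toeplitzSymbol_eq, ← hc, ← mul_assoc (Complex.exp _) (Complex.exp _), ← Complex.exp_add]
    push_cast
    congr 3
    ring
  rw [toeplitzDet, h, Matrix.det_smul, Matrix.det_mul_column, Matrix.det_mul_row, arcDet,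
    ← mul_assoc (∏ i : Fin n, _), ← Finset.prod_mul_distrib]
  simp [← Complex.exp_add]

/-- For fixed `n ≥ 1`, as `β = π − α → 0⁺`,
`ln D_n(α) = n² ln β − n ln(2π) + ln A_n + O_n(β²)`, with
`A_n = ∏_{k=0}^{n−1}(2^{2k}(k!)^4/((2k)!)^2)·2/(2k+1)`. -/
theorem toeplitzDet_near_pi (n : ℕ) (hn : 1 ≤ n) :
    ∃ C > (0 : ℝ), ∃ δ > (0 : ℝ), ∀ β : ℝ, 0 < β → β < δ →
      ‖Complex.log (toeplitzDet n (Real.pi - β))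
          - (((n : ℝ) ^ 2 * Real.log β - (n : ℝ) * Real.log (2 * Real.pi)
              + Real.log (∏ k ∈ Finset.range n,
                  (2 ^ (2 * k) * (k.factorial : ℝ) ^ 4 / ((2 * k).factorial : ℝ) ^ 2)
                    * (2 / (2 * (k : ℝ) + 1))) : ℝ) : ℂ)‖
        ≤ C * β ^ 2 := by
  have hexp : n + n * (n - 1) = n ^ 2 := by
    obtain ⟨m, rfl⟩ : ∃ m, n = m + 1 := ⟨n - 1, by omega⟩
    simp only [Nat.add_sub_cancel]
    ring
  set F := scaledArcDet n with hF
  set a : ℝ := ∏ k ∈ Finset.range n,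
    ((k.factorial : ℝ) ^ 4 / ((2 * k).factorial : ℝ) ^ 2 * (1 / (2 * (k : ℝ) + 1))) with ha
  have ha_pos : 0 < a := Finset.prod_pos fun k _ => by positivity
  have hF0 : F 0 = (a : ℂ) := by
    rw [hF, scaledArcDet_zero, ha]
    push_cast
    rfl
  have hA : ∏ k ∈ Finset.range n, (2 ^ (2 * k) * (k.factorial : ℝ) ^ 4 / ((2 * k).factorial : ℝ) ^ 2)
      * (2 / (2 * (k : ℝ) + 1)) = 2 ^ (n ^ 2) * a := by
    have h2 : (2 : ℝ) ^ (n ^ 2) = ∏ k ∈ Finset.range n, 2 ^ (2 * k + 1) := by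
      rw [Finset.prod_pow_eq_pow_sum, Finset.sum_add_distrib, ← Finset.mul_sum, mul_comm 2,
        Finset.sum_range_id_mul_two, Finset.sum_const, Finset.card_range, smul_eq_mul, mul_one,
        add_comm, hexp]
    rw [h2, ha, ← Finset.prod_mul_distrib]
    exact Finset.prod_congr rfl fun k _ => by ring
  have hslit : F 0 ∈ slitPlane := by
    rw [hF0]
    exact Complex.ofReal_mem_slitPlane.2 ha_pos
  have hlog : AnalyticAt ℂ (fun x => Complex.log (F x)) 0 :=
    (analyticAt_scaledArcDet n).clog hslit
  obtain ⟨C, hC, hbound⟩ := (hlog.isBigO_sub_of_even fun x => by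
    simp only [hF, scaledArcDet_neg]).exists_pos
  have hne : ∀ᶠ x in nhds (0 : ℂ), F x ≠ 0 :=
    (continuous_scaledArcDet n).continuousAt.eventually_ne (slitPlane_ne_zero hslit)
  obtain ⟨ε, hε, hball⟩ := Metric.eventually_nhds_iff.1 (hbound.bound.and hne)
  refine ⟨C * 4, by positivity, ε / 2, by positivity, fun β hβ hβε => ?_⟩
  obtain ⟨hle, hFβ⟩ := @hball ((2 * β : ℝ) : ℂ) (by
    rw [dist_zero_right, Complex.norm_real, Real.norm_of_nonneg (by positivity)]
    linarith)
  have hpi := Real.pi_pos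
  have hdet : toeplitzDet n (Real.pi - β)
      = (((2 * β) ^ n ^ 2 / (2 * Real.pi) ^ n : ℝ) : ℂ) * F ((2 * β : ℝ) : ℂ) := by
    rw [toeplitzDet_eq_arcDet, arcDet_eq, ← hexp, ← hF, pow_add, Complex.ofReal_div, div_pow]
    push_cast
    ring
  rw [hdet, Complex.log_ofReal_mul (by positivity) hFβ, hA, Real.log_div (by positivity)
    (by positivity), Real.log_pow, Real.log_pow, Real.log_mul two_ne_zero hβ.ne',
    Real.log_mul (by positivity) ha_pos.ne', Real.log_pow]
  have hloga : Complex.log (F 0) = (Real.log a : ℂ) := by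
    rw [hF0, Complex.ofReal_log ha_pos.le]
  rw [hloga] at hle
  have hnorm : ‖‖((2 * β : ℝ) : ℂ)‖ ^ 2‖ = 4 * β ^ 2 := by
    rw [Complex.norm_real, Real.norm_eq_abs, Real.norm_of_nonneg (by positivity),
      abs_of_nonneg (by positivity)]
    ring
  rw [hnorm, ← mul_assoc] at hle
  refine le_of_eq_of_le (congrArg norm ?_) hle
  push_cast
  ring
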